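/- Let A be a nonnegative vector in ℝⁿ, D = A₁+⋯+Aₙ+n, and p > D a real number, α = 1 − D/p. There is a constant C depending only on p and D such that for every C¹ function u with compact support in ℝⁿ and all distinct x, y ∈ ℝⁿ_*, |u(x) − u(y)| ≤ C |x−y|^α (∫_{ℝⁿ_*} z^A |∇u(z)|^p dz)^{1/p}. -/

import Mathlib

open MeasureTheory

def mcube (n : ℕ) : Set (EuclideanSpace ℝ (Fin n)) := {v | ∀ i, v i ∈ Set.Icc (1:ℝ) 2}

lemma mcube_eq (n : ℕ) : mcube n =
    (WithLp.ofLp : EuclideanSpace ℝ (Fin n) → (Fin n → ℝ)) ⁻¹' (Set.univ.pi fun _ => Set.Icc (1:ℝ) 2) := by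
  ext v
  simp only [mcube, Set.mem_ofPred_eq, Set.mem_preimage, Set.mem_univ_pi]

lemma mcube_meas (n : ℕ) : MeasurableSet (mcube n) := by
  rw [mcube_eq]
  exact (PiLp.volume_preserving_ofLp (Fin n)).measurable
    (MeasurableSet.univ_pi fun _ => measurableSet_Icc)

lemma mcube_vol (n : ℕ) : volume (mcube n) = 1 := by
  rw [mcube_eq, (PiLp.volume_preserving_ofLp (Fin n)).measure_preimage
    (MeasurableSet.univ_pi fun _ => measurableSet_Icc).nullMeasurableSet, volume_pi_pi]
  simp; norm_num

lemma m_lintegral_affine {n : ℕ} (F : EuclideanSpace ℝ (Fin n) → ENNReal)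
    (hF : Measurable F) (c : EuclideanSpace ℝ (Fin n)) {s : ℝ} (hs : 0 < s) :
    ∫⁻ v, F (c + s • v) = ENNReal.ofReal (s ^ (-(n:ℝ))) * ∫⁻ z, F z := by
  have h1 : ∫⁻ v, F (c + s • v) = ∫⁻ w, F (c + w) ∂(Measure.map (s • ·) volume) := by
    rw [lintegral_map (by fun_prop) (by fun_prop)]
  rw [h1, Measure.map_addHaar_smul _ hs.ne', lintegral_smul_measure,
    lintegral_add_left_eq_self]
  rw [smul_eq_mul, finrank_euclideanSpace_fin, abs_of_pos (by positivity),
    Real.rpow_neg hs.le, Real.rpow_natCast]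

lemma m_grad_norm {n : ℕ} (u : EuclideanSpace ℝ (Fin n) → ℝ) (z : EuclideanSpace ℝ (Fin n)) :
    ‖gradient u z‖ = ‖fderiv ℝ u z‖ := by
  simp [gradient]

lemma m_grad_cont {n : ℕ} {u : EuclideanSpace ℝ (Fin n) → ℝ} (hu : ContDiff ℝ 1 u) :
    Continuous (gradient u) := by
  unfold gradient
  exact (LinearIsometryEquiv.continuous _).comp (hu.continuous_fderiv one_ne_zero)

lemma m_step1 {n : ℕ} {A : Fin n → ℝ} (hA : ∀ i, 0 ≤ A i) {D p : ℝ} (hp : 0 < p)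
    (hD : (∑ i, A i) + n = D) {g : EuclideanSpace ℝ (Fin n) → EuclideanSpace ℝ (Fin n)}
    (hg : Continuous g) {x d : EuclideanSpace ℝ (Fin n)}
    (hx : ∀ i, 0 < A i → 0 < x i) (hd : ∀ i, 0 ≤ d i) {s : ℝ} (hs : 0 < s) :
    ∫⁻ v in mcube n, ‖g (x + d + s • v)‖ₑ ^ p ≤ ENNReal.ofReal (s ^ (-D)) *
      ∫⁻ z in {z : EuclideanSpace ℝ (Fin n) | ∀ i, 0 < A i → 0 < z i},
        ENNReal.ofReal ((∏ i, |z i| ^ A i) * ‖g z‖ ^ p) := by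
  set R := {z : EuclideanSpace ℝ (Fin n) | ∀ i, 0 < A i → 0 < z i} with hR
  have hRm : MeasurableSet R := by
    have : R = ⋂ i, ⋂ (_ : 0 < A i), {z : EuclideanSpace ℝ (Fin n) | 0 < z i} := by
      ext z; simp [hR]
    rw [this]
    refine MeasurableSet.iInter fun i => MeasurableSet.iInter fun _ => ?_
    exact measurableSet_lt measurable_const (by fun_prop)
  set F : EuclideanSpace ℝ (Fin n) → ENNReal := 
    R.indicator fun z => ENNReal.ofReal ((∏ i, |z i| ^ A i) * ‖g z‖ ^ p) with hF
  have hFm : Measurable F := by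
    refine Measurable.indicator ?_ hRm
    have := hg.measurable
    fun_prop
  rw [← lintegral_indicator hRm]
  have key : ∀ v ∈ mcube n, ‖g (x + d + s • v)‖ₑ ^ p ≤
      ENNReal.ofReal (s ^ (-∑ i, A i)) * F (x + d + s • v) := by
    intro v hv
    have hz : ∀ i, 0 < A i → s ≤ (x + d + s • v) i := by
      intro i hi
      have h1 := hx i hi
      have h2 := hd i
      have h3 := (hv i).1
      simp only [PiLp.add_apply, PiLp.smul_apply, smul_eq_mul]
      nlinarith
    set z := x + d + s • v
    have hzR : z ∈ R := fun i hi => hs.trans_le (hz i hi)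
    rw [hF, Set.indicator_of_mem hzR, ← ofReal_norm,
      ENNReal.ofReal_rpow_of_nonneg (norm_nonneg _) hp.le, ← ENNReal.ofReal_mul (by positivity)]
    apply ENNReal.ofReal_le_ofReal
    have hw : s ^ (∑ i, A i) ≤ ∏ i, |z i| ^ A i := by
      rw [Real.rpow_sum_of_pos hs]
      refine Finset.prod_le_prod (fun i _ => by positivity) fun i _ => ?_
      rcases (hA i).eq_or_lt with h | h
      · simp [← h]
      · exact Real.rpow_le_rpow hs.le ((hz i h).trans (le_abs_self _)) h.le
    have h1 : 1 ≤ s ^ (-∑ i, A i) * ∏ i, |z i| ^ A i := by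
      calc 1 = s ^ (-∑ i, A i) * s ^ (∑ i, A i) := by rw [← Real.rpow_add hs]; simp
        _ ≤ _ := by gcongr
    rw [← mul_assoc]
    exact le_mul_of_one_le_left (by positivity) h1
  calc _ ≤ ∫⁻ v in mcube n, ENNReal.ofReal (s ^ (-∑ i, A i)) * F (x + d + s • v) :=
        setLIntegral_mono' (mcube_meas n) key
    _ ≤ ∫⁻ v, ENNReal.ofReal (s ^ (-∑ i, A i)) * F (x + d + s • v) := setLIntegral_le_lintegral _ _
    _ = _ := by
      rw [lintegral_const_mul _ (by fun_prop), m_lintegral_affine F hFm _ hs, ← mul_assoc,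
        ← ENNReal.ofReal_mul (by positivity), ← Real.rpow_add hs, ← hD, neg_add]

lemma m_step2 {n : ℕ} {u : EuclideanSpace ℝ (Fin n) → ℝ} (hu : ContDiff ℝ 1 u)
    (x w : EuclideanSpace ℝ (Fin n)) {K : ℝ} (hw : ‖w‖ ≤ K) :
    ‖u x - u (x + w)‖ₑ ≤ ∫⁻ t in Set.Ioc (0:ℝ) 1,
      ENNReal.ofReal K * ‖gradient u (x + t • w)‖ₑ := by
  have hc : Continuous fun t : ℝ => fderiv ℝ u (x + t • w) w :=
    ((hu.continuous_fderiv one_ne_zero).comp (by fun_prop)).clm_apply continuous_const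
  have h1 : ∫ t in (0:ℝ)..1, fderiv ℝ u (x + t • w) w = u (x + w) - u x := by
    have := intervalIntegral.integral_eq_sub_of_hasDerivAt (a := 0) (b := 1)
      (f := fun t : ℝ => u (x + t • w)) (f' := fun t => fderiv ℝ u (x + t • w) w)
      (fun t _ => by
        have h := ((hu.differentiable one_ne_zero) (x + t • w)).hasFDerivAt
        have h' : HasDerivAt (fun t : ℝ => x + t • w) w t := by
          simpa using ((hasDerivAt_id t).smul_const w).const_add x
        exact h.comp_hasDerivAt t h')
      (hc.intervalIntegrable _ _)
    simpa using this
  rw [enorm_sub_rev, ← h1, intervalIntegral.integral_of_le zero_le_one]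
  refine (enorm_integral_le_lintegral_enorm _).trans (lintegral_mono fun t => ?_)
  rw [← ofReal_norm, ← ofReal_norm, m_grad_norm,
    ← ENNReal.ofReal_mul ((norm_nonneg w).trans hw)]
  apply ENNReal.ofReal_le_ofReal
  rw [mul_comm]
  exact (ContinuousLinearMap.le_opNorm _ _).trans (by gcongr)

lemma m_rpow_int {a : ℝ} (ha : a < 1) :
    ∫⁻ t in Set.Ioc (0:ℝ) 1, ENNReal.ofReal (t ^ (-a)) = ENNReal.ofReal (1 / (1 - a)) := by
  have hi := (intervalIntegral.intervalIntegrable_rpow' (a := 0) (b := 1) (r := -a) (by linarith))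
  rw [intervalIntegrable_iff_integrableOn_Ioc_of_le zero_le_one] at hi
  rw [← ofReal_integral_eq_lintegral_ofReal hi, ← intervalIntegral.integral_of_le zero_le_one,
    integral_rpow (Or.inl (by linarith))]
  · rw [Real.zero_rpow (by linarith)]; simp; ring_nf
  · filter_upwards [ae_restrict_mem measurableSet_Ioc] with t ht
    exact Real.rpow_nonneg ht.1.le _

lemma m_norm_le {n : ℕ} {w : EuclideanSpace ℝ (Fin n)} {b : ℝ} (hb : 0 ≤ b)
    (h : ∀ i, |w i| ≤ b) : ‖w‖ ≤ √n * b := by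
  rw [EuclideanSpace.norm_eq]
  apply Real.sqrt_le_iff.2 ⟨by positivity, ?_⟩
  rw [mul_pow, Real.sq_sqrt (by positivity)]
  calc ∑ i, ‖w i‖ ^ 2 ≤ ∑ i : Fin n, b ^ 2 := by
        gcongr with i; exact h i
    _ = _ := by simp

lemma m_main {n : ℕ} {A : Fin n → ℝ} (hA : ∀ i, 0 ≤ A i) {D p : ℝ} (hp : 1 ≤ p) (hDp : D < p)
    (hD : (∑ i, A i) + n = D) {u : EuclideanSpace ℝ (Fin n) → ℝ} (hu : ContDiff ℝ 1 u)
    (hus : HasCompactSupport u) {x d : EuclideanSpace ℝ (Fin n)} {r : ℝ} (hr : 0 < r)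
    (hx : ∀ i, 0 < A i → 0 < x i) (hd : ∀ i, 0 ≤ d i) (hdr : ∀ i, d i ≤ r) :
    ‖u x - ∫ v in mcube n, u (x + d + r • v)‖ₑ ≤
      ENNReal.ofReal (√n * (3 * r) * r ^ (-D/p) * (1 / (1 - D / p))) *
      (∫⁻ z in {z : EuclideanSpace ℝ (Fin n) | ∀ i, 0 < A i → 0 < z i},
        ENNReal.ofReal ((∏ i, |z i| ^ A i) * ‖gradient u z‖ ^ p)) ^ (1 / p) := by
  set J := ∫⁻ z in {z : EuclideanSpace ℝ (Fin n) | ∀ i, 0 < A i → 0 < z i},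
        ENNReal.ofReal ((∏ i, |z i| ^ A i) * ‖gradient u z‖ ^ p) with hJ
  have hp0 : 0 < p := by linarith
  have hg := m_grad_cont hu
  have : IsProbabilityMeasure (volume.restrict (mcube n)) := ⟨by simp [mcube_vol]⟩
  have hint : Integrable (fun v => u (x + d + r • v)) (volume.restrict (mcube n)) := by
    obtain ⟨C, hC⟩ := hu.continuous.bounded_above_of_compact_support hus
    refine Integrable.of_bound (C := C) ?_ (Filter.Eventually.of_forall fun v => hC _)
    exact (hu.continuous.comp (by fun_prop)).aestronglyMeasurable
  have e1 : u x - ∫ v in mcube n, u (x + d + r • v) =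
      ∫ v in mcube n, (u x - u (x + d + r • v)) := by
    rw [integral_sub (integrable_const _) hint]; simp
  rw [e1]
  set K := √n * (3 * r) with hK
  have hK0 : 0 ≤ K := by positivity
  have h2 : ∀ v ∈ mcube n, ‖u x - u (x + d + r • v)‖ₑ ≤ ∫⁻ t in Set.Ioc (0:ℝ) 1,
      ENNReal.ofReal K * ‖gradient u (x + t • (d + r • v))‖ₑ := by
    intro v hv
    rw [add_assoc]
    refine m_step2 hu x (d + r • v) (m_norm_le (by positivity) fun i => ?_)
    have := hv i
    have h3 := hd i
    have h4 := hdr i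
    simp only [PiLp.add_apply, PiLp.smul_apply, smul_eq_mul]
    rw [abs_of_nonneg (by nlinarith [this.1])]
    nlinarith [this.2]
  have h3 : ∀ t ∈ Set.Ioc (0:ℝ) 1, ∫⁻ v in mcube n,
      ENNReal.ofReal K * ‖gradient u (x + t • (d + r • v))‖ₑ ≤
      ENNReal.ofReal (K * r ^ (-D/p)) * J ^ (1/p) * ENNReal.ofReal (t ^ (-(D/p))) := by
    intro t ht
    have ht0 := ht.1
    have hm : Continuous fun v => gradient u (x + t • d + (t * r) • v) :=
      hg.comp (by fun_prop)
    have e : ∀ v, x + t • (d + r • v) = x + t • d + (t * r) • v := by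
      intro v; rw [smul_add, smul_smul, add_assoc]
    simp_rw [e]
    rw [lintegral_const_mul _ hm.measurable.enorm]
    have h := eLpNorm'_le_eLpNorm'_of_exponent_le one_pos hp (volume.restrict (mcube n))
      hm.aestronglyMeasurable
    simp only [eLpNorm', ENNReal.rpow_one, div_one] at h
    have h' := m_step1 hA hp0 hD hg hx (d := t • d) (s := t * r)
      (fun i => by simpa using mul_nonneg ht0.le (hd i)) (by positivity)
    have h'' := h.trans (ENNReal.rpow_le_rpow h' (by positivity : 0 ≤ 1 / p))
    rw [ENNReal.mul_rpow_of_nonneg _ _ (by positivity : 0 ≤ 1 / p),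
      ENNReal.ofReal_rpow_of_nonneg (by positivity) (by positivity : 0 ≤ 1 / p),
      ← Real.rpow_mul (by positivity), Real.mul_rpow ht0.le hr.le,
      ENNReal.ofReal_mul (by positivity)] at h''
    have ee : -D * (1 / p) = -D / p := by ring
    have ee' : -(D / p) = -D / p := by ring
    rw [ee] at h''
    rw [ee', ENNReal.ofReal_mul hK0]
    refine (mul_le_mul_right h'' _).trans (le_of_eq ?_)
    rw [← hJ]
    ring
  calc _ ≤ ∫⁻ v in mcube n, ‖u x - u (x + d + r • v)‖ₑ := enorm_integral_le_lintegral_enorm _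
    _ ≤ ∫⁻ v in mcube n, ∫⁻ t in Set.Ioc (0:ℝ) 1,
      ENNReal.ofReal K * ‖gradient u (x + t • (d + r • v))‖ₑ :=
        setLIntegral_mono' (mcube_meas n) h2
    _ = ∫⁻ t in Set.Ioc (0:ℝ) 1, ∫⁻ v in mcube n,
      ENNReal.ofReal K * ‖gradient u (x + t • (d + r • v))‖ₑ := by
        apply lintegral_lintegral_swap
        have : Continuous fun q : EuclideanSpace ℝ (Fin n) × ℝ =>
          gradient u (x + q.2 • (d + r • q.1)) := hg.comp (by fun_prop)
        exact (this.measurable.enorm.const_mul _).aemeasurable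
    _ ≤ ∫⁻ t in Set.Ioc (0:ℝ) 1,
      ENNReal.ofReal (K * r ^ (-D/p)) * J ^ (1/p) * ENNReal.ofReal (t ^ (-(D/p))) :=
        setLIntegral_mono' measurableSet_Ioc h3
    _ = _ := by
      rw [lintegral_const_mul _ (by fun_prop), m_rpow_int ((div_lt_one hp0).2 hDp),
        ENNReal.ofReal_mul (p := K * r ^ (-D/p)) (by positivity)]
      ring

/-- Weighted Morrey inequality, with constant depending only on `p` and `D`. -/
theorem weighted_morrey_inequality (D p : ℝ) (hpD : D < p) :
    ∃ C : ℝ, ∀ (n : ℕ) (A : Fin n → ℝ), (∀ i, 0 ≤ A i) → (∑ i, A i) + n = D →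
      ∀ Rstar : Set (EuclideanSpace ℝ (Fin n)),
        Rstar = {x | ∀ i, 0 < A i → 0 < x i} →
      ∀ u : EuclideanSpace ℝ (Fin n) → ℝ, ContDiff ℝ 1 u → HasCompactSupport u →
      ∀ x ∈ Rstar, ∀ y ∈ Rstar, x ≠ y →
        |u x - u y| ≤ C * ‖x - y‖ ^ (1 - D / p) *
          (∫ z in Rstar, (∏ i, |z i| ^ A i) * ‖gradient u z‖ ^ p) ^ (1 / p) := by
  refine ⟨6 * √D * (1 / (1 - D / p)), ?_⟩
  rintro n A hA hD R rfl u hu hus x hx y hy hxy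
  have hn : 1 ≤ n := by
    rcases Nat.eq_zero_or_pos n with rfl | h
    · exact (hxy (Subsingleton.elim _ _)).elim
    · exact h
  have hnD : (n:ℝ) ≤ D := by
    have := Finset.sum_nonneg (s := Finset.univ) (fun i _ => hA i)
    linarith
  have hD1 : 1 ≤ D := le_trans (by exact_mod_cast hn) hnD
  have hp : 1 ≤ p := by linarith
  have hp0 : 0 < p := by linarith
  have hfrac : 0 < 1 - D / p := by
    have := (div_lt_one hp0).2 hpD
    linarith
  set r := ‖x - y‖ with hrdef
  have hr : 0 < r := norm_pos_iff.2 (sub_ne_zero.2 hxy)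
  have hco : ∀ i, |x i - y i| ≤ r := fun i => by
    simpa using PiLp.norm_apply_le (x - y) i
  set m : EuclideanSpace ℝ (Fin n) := WithLp.toLp 2 fun i => max (x i) (y i) with hm
  have hg := m_grad_cont hu
  have hgs : HasCompactSupport (gradient u) := by
    have := hus.fderiv ℝ
    unfold gradient
    exact this.comp_left (map_zero _)
  set W : EuclideanSpace ℝ (Fin n) → ℝ :=
    fun z => (∏ i, |z i| ^ A i) * ‖gradient u z‖ ^ p with hW
  have hWc : Continuous W := by
    refine Continuous.mul (continuous_finsetProd _ fun i _ => ?_) ?_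
    · exact Continuous.rpow_const (by fun_prop) fun _ => Or.inr (hA i)
    · exact hg.norm.rpow_const fun _ => Or.inr hp0.le
  have hWs : HasCompactSupport W := by
    refine HasCompactSupport.mul_left ?_
    exact hgs.comp_left (g := fun a => ‖a‖ ^ p) (by simp [hp0.ne'])
  have hWi : Integrable W := hWc.integrable_of_hasCompactSupport hWs
  set R := {z : EuclideanSpace ℝ (Fin n) | ∀ i, 0 < A i → 0 < z i}
  have hW0 : ∀ z, 0 ≤ W z := fun z => by simp only [hW]; positivity
  have hJ : ∫⁻ z in R, ENNReal.ofReal (W z) = ENNReal.ofReal (∫ z in R, W z) :=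
    (ofReal_integral_eq_lintegral_ofReal hWi.integrableOn
      (Filter.Eventually.of_forall hW0)).symm
  have hI0 : 0 ≤ ∫ z in R, W z := integral_nonneg hW0
  have hIp : 0 ≤ (∫ z in R, W z) ^ (1 / p) := Real.rpow_nonneg hI0 _
  have main : ∀ q ∈ R, (∀ i, q i ≤ m i) → (∀ i, m i - q i ≤ r) →
      |u q - ∫ v in mcube n, u (m + r • v)| ≤ 
      (√n * (3 * r) * r ^ (-D/p) * (1 / (1 - D / p))) * (∫ z in R, W z) ^ (1 / p) := by
    intro q hq h1 h2
    have hk0 : 0 ≤ √n * (3 * r) * r ^ (-D/p) * (1 / (1 - D / p)) :=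
      mul_nonneg (by positivity) (one_div_nonneg.2 hfrac.le)
    have h := m_main hA hp hpD hD hu hus (x := q) (d := m - q) hr hq
      (fun i => by simpa using h1 i) (fun i => by simpa using h2 i)
    rw [show q + (m - q) = m by abel] at h
    have h' : ‖u q - ∫ v in mcube n, u (m + r • v)‖ₑ ≤ ENNReal.ofReal (√n * (3 * r) * r ^ (-D/p) * (1 / (1 - D / p))) * (∫⁻ z in R, ENNReal.ofReal (W z)) ^ (1 / p) := h
    rw [hJ, ENNReal.ofReal_rpow_of_nonneg hI0 (one_div_nonneg.2 hp0.le), ← ENNReal.ofReal_mul hk0,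
      ← ofReal_norm, ENNReal.ofReal_le_ofReal_iff (mul_nonneg hk0 hIp)] at h'
    exact h'
  have m1 := main x hx (fun i => le_max_left _ _) (fun i => by
    have := abs_le.1 (hco i)
    simp only [hm]
    rcases max_cases (x i) (y i) with h | h <;> rw [h.1] <;> linarith)
  have m2 := main y hy (fun i => le_max_right _ _) (fun i => by
    have := abs_le.1 (hco i)
    simp only [hm]
    rcases max_cases (x i) (y i) with h | h <;> rw [h.1] <;> linarith)
  have er : r ^ (1 - D / p) = r * r ^ (-D / p) := by
    rw [sub_eq_add_neg, Real.rpow_add hr, Real.rpow_one, neg_div]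
  have hsq : √(n:ℝ) ≤ √D := Real.sqrt_le_sqrt hnD
  rw [abs_sub_comm] at m2
  calc |u x - u y| ≤ _ := abs_sub_le _ (∫ v in mcube n, u (m + r • v)) _
    _ ≤ _ := add_le_add m1 m2
    _ = 6 * √n * (1 / (1 - D / p)) * r ^ (1 - D / p) * (∫ z in R, W z) ^ (1 / p) := by
      rw [er]; ring
    _ ≤ 6 * √D * (1 / (1 - D / p)) * r ^ (1 - D / p) * (∫ z in R, W z) ^ (1 / p) := by
      refine mul_le_mul_of_nonneg_right ?_ hIp
      refine mul_le_mul_of_nonneg_right ?_ (Real.rpow_nonneg hr.le _)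
      refine mul_le_mul_of_nonneg_right ?_ (one_div_nonneg.2 hfrac.le)
      linarith
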